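/- Let ξ be an extremal real number with an associated Fibonacci sequence (W_k)_{k≥1} in 𝒫, and for each i ≥ 1 let U_i = Φ(u_i) where u_i is the prefix of f_{a,b} of length i. Then there exist constants c₁, c₂ > 0, independent of i, such that c₁·|det U_i|/‖U_i‖ ≤ ‖(ξ,−1)U_i‖ ≤ c₂·|det U_i|/‖U_i‖ for all i ≥ 1. -/

import Mathlib

open Matrix

/-- 2×2 integer matrices. -/
abbrev M2 : Type := Matrix (Fin 2) (Fin 2) ℤ

/-- The content of an integer matrix: the gcd of its coefficients. -/
def content (A : M2) : ℕ :=
  Nat.gcd (Nat.gcd (A 0 0).natAbs (A 0 1).natAbs) (Nat.gcd (A 1 0).natAbs (A 1 1).natAbs)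

/-- A matrix is primitive if its content is 1. -/
def Primitive (A : M2) : Prop := content A = 1

/-- Membership in 𝒫: primitive with nonzero determinant. -/
def MemP (A : M2) : Prop := Primitive A ∧ A.det ≠ 0

/-- `A^red`: the primitive matrix such that `A = content A • A^red`. -/
def red (A : M2) : M2 := Matrix.of fun i j => A i j / (content A : ℤ)

/-- The group operation of 𝒫: `A * B = (AB)^red`. -/
def pmul (A B : M2) : M2 := red (A * B)

/-- A Fibonacci sequence in 𝒫 (indices from 1). -/
def IsFibP (W : ℕ → M2) : Prop :=
  (∀ i, 1 ≤ i → MemP (W i)) ∧ ∀ i, 1 ≤ i → W (i + 2) = pmul (W (i + 1)) (W i)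

/-- Admissibility of a Fibonacci sequence in 𝒫: there is a non-symmetric,
non-skew-symmetric N ∈ 𝒫 such that W_i N_i is symmetric for all i ≥ 1,
where N_i = ᵗN for odd i and N_i = N for even i. -/
def AdmissibleFib (W : ℕ → M2) : Prop :=
  ∃ N : M2, MemP N ∧ N ≠ Nᵀ ∧ N ≠ -Nᵀ ∧
    ∀ i, 1 ≤ i → (W i * (if i % 2 = 1 then Nᵀ else N)).IsSymm

/-- The norm of an integer 2×2 matrix: max absolute value of coefficients, as a real. -/
noncomputable def mnorm (A : M2) : ℝ :=
  max (max |(A 0 0 : ℝ)| |(A 0 1 : ℝ)|) (max |(A 1 0 : ℝ)| |(A 1 1 : ℝ)|)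

/-- The sequence is unbounded in norm. -/
def UnboundedSeq (W : ℕ → M2) : Prop := ∀ C : ℝ, ∃ i, 1 ≤ i ∧ C < mnorm (W i)

/-- The golden ratio γ = (1+√5)/2. -/
noncomputable def gam : ℝ := (1 + Real.sqrt 5) / 2

/-- Norm of the row vector (ξ, -1)·A. -/
noncomputable def xiNorm (ξ : ℝ) (A : M2) : ℝ :=
  max |ξ * (A 0 0 : ℝ) - (A 1 0 : ℝ)| |ξ * (A 0 1 : ℝ) - (A 1 1 : ℝ)|

/-- ξ is extremal: neither rational nor quadratic over ℚ, and for each X ≥ 1 the system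
|x₀| ≤ X, |x₀ξ - x₁| ≤ c X^(-1/γ), |x₀ξ² - x₂| ≤ c X^(-1/γ) has a nonzero integer solution. -/
def IsExtremal (ξ : ℝ) : Prop :=
  (∀ a b c : ℚ, ¬(a = 0 ∧ b = 0 ∧ c = 0) → (a : ℝ) * ξ ^ 2 + (b : ℝ) * ξ + (c : ℝ) ≠ 0) ∧
  ∃ c : ℝ, 0 < c ∧ ∀ X : ℝ, 1 ≤ X → ∃ x₀ x₁ x₂ : ℤ,
    ¬(x₀ = 0 ∧ x₁ = 0 ∧ x₂ = 0) ∧ |(x₀ : ℝ)| ≤ X ∧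
    |(x₀ : ℝ) * ξ - (x₁ : ℝ)| ≤ c * X ^ (-1 / gam) ∧
    |(x₀ : ℝ) * ξ ^ 2 - (x₂ : ℝ)| ≤ c * X ^ (-1 / gam)

/-- The Fibonacci sequence `W` in 𝒫 is associated to the extremal real number ξ:
it is an unbounded admissible Fibonacci sequence in 𝒫 with
‖W_{i+1}‖ ≍ ‖W_i‖^γ, ‖(ξ,-1)W_i‖ ≍ ‖W_i‖⁻¹ and |det W_i| ≍ 1. -/
def IsAssociated (ξ : ℝ) (W : ℕ → M2) : Prop :=
  IsFibP W ∧ UnboundedSeq W ∧ AdmissibleFib W ∧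
  ∃ c₁ c₂ c₃ c₄ c₅ c₆ : ℝ, 0 < c₁ ∧ 0 < c₂ ∧ 0 < c₃ ∧ 0 < c₄ ∧ 0 < c₅ ∧ 0 < c₆ ∧
    ∀ i, 1 ≤ i →
      c₁ * mnorm (W i) ^ gam ≤ mnorm (W (i + 1)) ∧
      mnorm (W (i + 1)) ≤ c₂ * mnorm (W i) ^ gam ∧
      c₃ * (mnorm (W i))⁻¹ ≤ xiNorm ξ (W i) ∧
      xiNorm ξ (W i) ≤ c₄ * (mnorm (W i))⁻¹ ∧
      c₅ ≤ |((W i).det : ℝ)| ∧ |((W i).det : ℝ)| ≤ c₆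

/-- Membership in GL₂(ℤ): integer matrix of determinant ±1. -/
def InGL2Z (A : M2) : Prop := A.det = 1 ∨ A.det = -1

/-- ξ is badly approximable: irrational and |ξ - p/q| > c/q² for all rationals p/q. -/
def BadlyApprox (ξ : ℝ) : Prop :=
  Irrational ξ ∧ ∃ c : ℝ, 0 < c ∧ ∀ p q : ℤ, q ≠ 0 → c / (q : ℝ) ^ 2 < |ξ - (p : ℝ) / (q : ℝ)|

/-- Partial quotients of the continued fraction expansion: `cfA n ξ` is `aₙ`
where ξ = [a₀, a₁, a₂, …]. -/
noncomputable def cfA : ℕ → ℝ → ℤ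
  | 0, ξ => ⌊ξ⌋
  | n + 1, ξ => cfA n (ξ - ⌊ξ⌋)⁻¹

/-- A Fibonacci sequence of words (indices from 1). -/
def FibWordSeq {α : Type} (w : ℕ → List α) : Prop := ∀ i, 1 ≤ i → w (i + 2) = w (i + 1) ++ w i

/-- `b` (indexed from 1: the limit word is b₁b₂b₃…) is the infinite limit word of the
sequence of words `w`: every `w k` (k ≥ 2) is a prefix of it, and their lengths are unbounded. -/
def IsLimitWord {α : Type} (w : ℕ → List α) (b : ℕ → α) : Prop :=
  (∀ n : ℕ, ∃ k, 2 ≤ k ∧ n ≤ (w k).length) ∧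
  ∀ k, 2 ≤ k → ∀ j, (h : j < (w k).length) → (w k).get ⟨j, h⟩ = b (j + 1)

/-- The Fibonacci sequence of words over the alphabet E = {a, b} (with `b = false`,
`a = true`): w₁ = b, w₂ = a, w_{k+2} = w_{k+1} w_k.  Its limit is f_{a,b}. -/
def fw : ℕ → List Bool
  | 0 => []
  | 1 => [false]
  | 2 => [true]
  | n + 3 => fw (n + 2) ++ fw (n + 1)

/-- The prefix of length `i` of the infinite Fibonacci word `f_{a,b}`
(note `fw (i+2)` is a prefix of `f_{a,b}` of length ≥ i). -/
def fpref (i : ℕ) : List Bool := (fw (i + 2)).take i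

/-- The monoid morphism Φ : E* → (𝒫, *) with Φ(b) = W₁, Φ(a) = W₂
(the letter `b` is `false` and `a` is `true`). -/
def PhiW (W1 W2 : M2) : List Bool → M2
  | [] => 1
  | x :: u => pmul (if x then W2 else W1) (PhiW W1 W2 u)

/-- The set 𝒮₁ of real matrices (a b; c d) with a ≥ max{b,c} and min{b,c} ≥ d ≥ 0. -/
def S1 : Set (Matrix (Fin 2) (Fin 2) ℝ) :=
  {A | max (A 0 1) (A 1 0) ≤ A 0 0 ∧ A 1 1 ≤ min (A 0 1) (A 1 0) ∧ 0 ≤ A 1 1}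

/-- The set 𝒮 = 𝒮₁ ∩ GL₂(ℤ), viewed as a set of integer matrices. -/
def Sset : Set M2 :=
  {A | (A.map (Int.cast : ℤ → ℝ)) ∈ S1 ∧ (A.det = 1 ∨ A.det = -1)}

/-- ξ is an extremal real number with an associated Fibonacci sequence in GL₂(ℤ). -/
def HasGLAssoc (ξ : ℝ) : Prop :=
  IsExtremal ξ ∧ ∃ W : ℕ → M2, IsAssociated ξ W ∧ ∀ i, 1 ≤ i → InGL2Z (W i)

/-- ξ is an extremal real number with an associated Fibonacci sequence in 𝒮. -/
def HasSAssoc (ξ : ℝ) : Prop :=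
  IsExtremal ξ ∧ ∃ W : ℕ → M2, IsAssociated ξ W ∧ ∀ i, 1 ≤ i → W i ∈ Sset

lemma mul_entry (A B : M2) (i j : Fin 2) :
    ((A * B) i j : ℝ) = A i 0 * B 0 j + A i 1 * B 1 j := by
  simp [Matrix.mul_apply, Fin.sum_univ_two]

lemma det_cast (A : M2) : (A.det : ℝ) = A 0 0 * A 1 1 - A 0 1 * A 1 0 := by
  simp [Matrix.det_fin_two]

lemma abs_entry_le_mnorm (A : M2) (i j : Fin 2) : |(A i j : ℝ)| ≤ mnorm A := by
  unfold mnorm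
  fin_cases i <;> fin_cases j <;> simp

lemma mnorm_le {A : M2} {C : ℝ} (h : ∀ i j, |(A i j : ℝ)| ≤ C) : mnorm A ≤ C := by
  unfold mnorm
  simp [h]

lemma mnorm_nonneg (A : M2) : 0 ≤ mnorm A := (abs_nonneg _).trans (abs_entry_le_mnorm A 0 0)

lemma xiNorm_nonneg (ξ : ℝ) (A : M2) : 0 ≤ xiNorm ξ A := (abs_nonneg _).trans (le_max_left _ _)

lemma one_le_mnorm {A : M2} (h : A.det ≠ 0) : 1 ≤ mnorm A := by
  obtain ⟨i, j, hij⟩ : ∃ i j, A i j ≠ 0 := by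
    by_contra! H
    exact h (by simp [Matrix.det_fin_two, H])
  refine le_trans ?_ (abs_entry_le_mnorm A i j)
  exact_mod_cast Int.one_le_abs hij

lemma mnorm_nsmul (c : ℕ) (A : M2) : mnorm (c • A) = c * mnorm A := by
  simp only [mnorm, Matrix.smul_apply, nsmul_eq_mul, Int.cast_mul, Int.cast_natCast, abs_mul,
    Nat.abs_cast]
  rw [mul_max_of_nonneg _ _ (Nat.cast_nonneg c), mul_max_of_nonneg _ _ (Nat.cast_nonneg c),
    mul_max_of_nonneg _ _ (Nat.cast_nonneg c)]

lemma xiNorm_nsmul (ξ : ℝ) (c : ℕ) (A : M2) : xiNorm ξ (c • A) = c * xiNorm ξ A := by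
  simp only [xiNorm, Matrix.smul_apply, nsmul_eq_mul, Int.cast_mul, Int.cast_natCast]
  rw [mul_max_of_nonneg _ _ (Nat.cast_nonneg c), ← Nat.abs_cast (R := ℝ) c, ← abs_mul, ← abs_mul,
    Nat.abs_cast]
  congr 2 <;> ring

lemma abs_det_nsmul (c : ℕ) (A : M2) : |((c • A).det : ℝ)| = (c : ℝ) ^ 2 * |(A.det : ℝ)| := by
  have h : ((c • A).det : ℝ) = (c : ℝ) ^ 2 * (A.det : ℝ) := by
    rw [Matrix.det_smul_of_tower]
    simp
  rw [h, abs_mul, abs_of_nonneg (by positivity)]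

lemma content_dvd (A : M2) (i j : Fin 2) : (content A : ℤ) ∣ A i j := by
  rw [Int.natCast_dvd]
  unfold content
  fin_cases i <;> fin_cases j
  · exact (Nat.gcd_dvd_left _ _).trans (Nat.gcd_dvd_left _ _)
  · exact (Nat.gcd_dvd_left _ _).trans (Nat.gcd_dvd_right _ _)
  · exact (Nat.gcd_dvd_right _ _).trans (Nat.gcd_dvd_left _ _)
  · exact (Nat.gcd_dvd_right _ _).trans (Nat.gcd_dvd_right _ _)

lemma content_nsmul_red (A : M2) : content A • red A = A := by
  ext i j
  simp only [red, Matrix.smul_apply, Matrix.of_apply, nsmul_eq_mul]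
  exact Int.mul_ediv_cancel' (content_dvd A i j)

lemma content_ne_zero {A : M2} (h : A.det ≠ 0) : content A ≠ 0 := by
  intro h0
  apply h
  rw [← content_nsmul_red A, h0]
  simp

/-- The product in `M₂(ℤ)`, without reduction, of the matrices attached to the letters of a word. -/
def wordProd (A B : M2) (u : List Bool) : M2 := (u.map fun x => if x then B else A).prod

lemma wordProd_append (A B : M2) (u v : List Bool) :
    wordProd A B (u ++ v) = wordProd A B u * wordProd A B v := by
  simp [wordProd]

lemma wordProd_det_ne_zero {A B : M2} (hA : A.det ≠ 0) (hB : B.det ≠ 0) (u : List Bool) :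
    (wordProd A B u).det ≠ 0 := by
  induction u with
  | nil => simp [wordProd]
  | cons x u ih =>
    have : wordProd A B (x :: u) = (if x then B else A) * wordProd A B u := by simp [wordProd]
    rw [this, Matrix.det_mul]
    cases x <;> simp_all

lemma exists_wordProd_eq_nsmul_PhiW {A B : M2} (hA : A.det ≠ 0) (hB : B.det ≠ 0)
    (u : List Bool) : ∃ c : ℕ, c ≠ 0 ∧ wordProd A B u = c • PhiW A B u := by
  induction u with
  | nil => exact ⟨1, one_ne_zero, by simp [wordProd, PhiW]⟩
  | cons x u ih =>
    obtain ⟨c, hc, h⟩ := ih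
    have h1 : wordProd A B (x :: u) = (if x then B else A) * wordProd A B u := by simp [wordProd]
    have h2 : wordProd A B (x :: u) =
        (c * content ((if x then B else A) * PhiW A B u)) • PhiW A B (x :: u) := by
      rw [h1, h, mul_smul, PhiW, pmul, content_nsmul_red, mul_smul_comm]
    refine ⟨_, ?_, h2⟩
    intro h0
    rw [h0] at h2
    apply wordProd_det_ne_zero hA hB (x :: u)
    rw [h2]
    simp

lemma exists_wordProd_fw_eq_nsmul {W : ℕ → M2} (hW : IsFibP W) (n : ℕ) :
    ∃ c : ℕ, c ≠ 0 ∧ wordProd (W 1) (W 2) (fw (n + 1)) = c • W (n + 1) := by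
  induction n using Nat.twoStepInduction with
  | zero => exact ⟨1, one_ne_zero, by simp [wordProd, fw]⟩
  | one => exact ⟨1, one_ne_zero, by simp [wordProd, fw]⟩
  | more n ih1 ih2 =>
    obtain ⟨c, hc, h⟩ := ih1
    obtain ⟨d, hd, h'⟩ := ih2
    refine ⟨d * c * content (W (n + 1 + 1) * W (n + 1)), ?_, ?_⟩
    · refine mul_ne_zero (mul_ne_zero hd hc) (content_ne_zero ?_)
      rw [Matrix.det_mul]
      exact mul_ne_zero (hW.1 _ (by omega)).2 (hW.1 _ (by omega)).2
    · have e : fw (n + 2 + 1) = fw (n + 1 + 1) ++ fw (n + 1) := rfl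
      rw [e, wordProd_append, h, h', mul_smul, show n + 2 + 1 = n + 1 + 2 by ring,
        hW.2 (n + 1) (by omega), pmul, content_nsmul_red, smul_mul_assoc, mul_smul_comm, mul_smul]

/-- The operator norm of `A` for the norm `|x| + K |y|`, in the basis `(1, ξ)`, `(0, 1)`. -/
noncomputable def adaptedNorm (ξ K : ℝ) (A : M2) : ℝ :=
  max (|(A 0 0 : ℝ) + ξ * A 0 1| + K * |(A 1 0 - ξ * A 0 0) + ξ * (A 1 1 - ξ * A 0 1)|)
    (|(A 0 1 : ℝ)| / K + |(A 1 1 : ℝ) - ξ * A 0 1|)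

lemma adaptedNorm_one (ξ K : ℝ) : adaptedNorm ξ K 1 = 1 := by
  simp [adaptedNorm]

lemma adaptedNorm_mul_le {K : ℝ} (ξ : ℝ) (hK : 0 < K) (A B : M2) :
    adaptedNorm ξ K (A * B) ≤ adaptedNorm ξ K A * adaptedNorm ξ K B := by
  set t := (A 0 0 : ℝ) + ξ * A 0 1 with ht
  set p := ((A 1 0 : ℝ) - ξ * A 0 0) + ξ * (A 1 1 - ξ * A 0 1) with hp
  set s := (A 0 1 : ℝ) with hs
  set q := (A 1 1 : ℝ) - ξ * A 0 1 with hq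
  set t' := (B 0 0 : ℝ) + ξ * B 0 1 with ht'
  set p' := ((B 1 0 : ℝ) - ξ * B 0 0) + ξ * (B 1 1 - ξ * B 0 1) with hp'
  set s' := (B 0 1 : ℝ) with hs'
  set q' := (B 1 1 : ℝ) - ξ * B 0 1 with hq'
  have hAB : adaptedNorm ξ K (A * B) =
      max (|t * t' + s * p'| + K * |p * t' + q * p'|) (|t * s' + s * q'| / K + |p * s' + q * q'|) := by
    have e1 : ((A * B) 0 0 : ℝ) + ξ * (A * B) 0 1 = t * t' + s * p' := by
      rw [mul_entry, mul_entry]; ring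
    have e2 : ((A * B) 1 0 - ξ * (A * B) 0 0) + ξ * ((A * B) 1 1 - ξ * (A * B) 0 1) =
        p * t' + q * p' := by
      simp only [mul_entry, hp, hq, ht', hp']; ring
    have e3 : ((A * B) 0 1 : ℝ) = t * s' + s * q' := by
      rw [mul_entry]; ring
    have e4 : ((A * B) 1 1 : ℝ) - ξ * (A * B) 0 1 = p * s' + q * q' := by
      rw [mul_entry, mul_entry]; ring
    rw [adaptedNorm, e2, e1, e4, e3]
  have hA : adaptedNorm ξ K A = max (|t| + K * |p|) (|s| / K + |q|) := rfl
  have hB : adaptedNorm ξ K B = max (|t'| + K * |p'|) (|s'| / K + |q'|) := rfl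
  have a1 : |t| + K * |p| ≤ adaptedNorm ξ K A := hA ▸ le_max_left _ _
  have a2 : |s| / K + |q| ≤ adaptedNorm ξ K A := hA ▸ le_max_right _ _
  have b1 : |t'| + K * |p'| ≤ adaptedNorm ξ K B := hB ▸ le_max_left _ _
  have b2 : |s'| / K + |q'| ≤ adaptedNorm ξ K B := hB ▸ le_max_right _ _
  have h0 : 0 ≤ adaptedNorm ξ K A := le_trans (by positivity) a1
  have e1 : |t * t' + s * p'| ≤ |t| * |t'| + |s| * |p'| := by
    simpa [abs_mul] using abs_add_le (t * t') (s * p')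
  have e2 : |p * t' + q * p'| ≤ |p| * |t'| + |q| * |p'| := by
    simpa [abs_mul] using abs_add_le (p * t') (q * p')
  have e3 : |t * s' + s * q'| ≤ |t| * |s'| + |s| * |q'| := by
    simpa [abs_mul] using abs_add_le (t * s') (s * q')
  have e4 : |p * s' + q * q'| ≤ |p| * |s'| + |q| * |q'| := by
    simpa [abs_mul] using abs_add_le (p * s') (q * q')
  rw [hAB]
  apply max_le
  · calc _ ≤ (|t| * |t'| + |s| * |p'|) + K * (|p| * |t'| + |q| * |p'|) := by gcongr
      _ = (|t| + K * |p|) * |t'| + (|s| / K + |q|) * (K * |p'|) := by field_simp; ring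
      _ ≤ adaptedNorm ξ K A * |t'| + adaptedNorm ξ K A * (K * |p'|) := by gcongr
      _ = adaptedNorm ξ K A * (|t'| + K * |p'|) := by ring
      _ ≤ _ := by gcongr
  · calc _ ≤ (|t| * |s'| + |s| * |q'|) / K + (|p| * |s'| + |q| * |q'|) := by gcongr
      _ = (|t| + K * |p|) * (|s'| / K) + (|s| / K + |q|) * |q'| := by field_simp; ring
      _ ≤ adaptedNorm ξ K A * (|s'| / K) + adaptedNorm ξ K A * |q'| := by gcongr
      _ = adaptedNorm ξ K A * (|s'| / K + |q'|) := by ring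
      _ ≤ _ := by gcongr

lemma adaptedNorm_nsmul {K : ℝ} (ξ : ℝ) (c : ℕ) (A : M2) :
    adaptedNorm ξ K (c • A) = c * adaptedNorm ξ K A := by
  have hc : |(c : ℝ)| = c := Nat.abs_cast c
  simp only [adaptedNorm, Matrix.smul_apply, nsmul_eq_mul, Int.cast_mul, Int.cast_natCast]
  rw [mul_max_of_nonneg _ _ (Nat.cast_nonneg c)]
  congr 1
  · rw [show (c : ℝ) * A 0 0 + ξ * (c * A 0 1) = c * (A 0 0 + ξ * A 0 1) by ring,
      show (c * A 1 0 - ξ * (c * A 0 0)) + ξ * (c * A 1 1 - ξ * (c * A 0 1)) =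
        (c : ℝ) * ((A 1 0 - ξ * A 0 0) + ξ * (A 1 1 - ξ * A 0 1)) by ring, abs_mul, abs_mul, hc]
    ring
  · rw [show (c * A 1 1 : ℝ) - ξ * (c * A 0 1) = c * (A 1 1 - ξ * A 0 1) by ring, abs_mul, abs_mul,
      hc]
    ring

lemma mnorm_le_adaptedNorm {K : ℝ} (ξ : ℝ) (hK : 1 ≤ K) (A : M2) :
    mnorm A ≤ (1 + |ξ|) ^ 2 * K * adaptedNorm ξ K A := by
  set N := adaptedNorm ξ K A with hN
  set t := (A 0 0 : ℝ) + ξ * A 0 1 with ht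
  set p := ((A 1 0 : ℝ) - ξ * A 0 0) + ξ * (A 1 1 - ξ * A 0 1) with hp
  set s := (A 0 1 : ℝ) with hs
  set q := (A 1 1 : ℝ) - ξ * A 0 1 with hq
  have hK0 : 0 < K := by linarith
  have a1 : |t| + K * |p| ≤ N := le_max_left _ _
  have a2 : |s| / K + |q| ≤ N := le_max_right _ _
  have N0 : 0 ≤ N := le_trans (by positivity) a1
  have NK : N ≤ K * N := by nlinarith
  have bt : |t| ≤ K * N := by nlinarith [abs_nonneg p]
  have bp : |p| ≤ K * N := by nlinarith [abs_nonneg p, abs_nonneg t]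
  have bq : |q| ≤ K * N := by
    have : 0 ≤ |s| / K := by positivity
    linarith
  have bs : |s| ≤ K * N := by
    have : |s| / K ≤ N := by linarith [abs_nonneg q]
    rw [div_le_iff₀ hK0] at this
    linarith
  have x0 := abs_nonneg ξ
  have h00 : (A 0 0 : ℝ) = t - ξ * s := by simp [ht, hs]
  have h11 : (A 1 1 : ℝ) = q + ξ * s := by simp [hq, hs]
  have h10 : (A 1 0 : ℝ) = p + ξ * (t - ξ * s) - ξ * q := by simp only [hp, ht, hs, hq]; ring
  have c00 : |(A 0 0 : ℝ)| ≤ (1 + |ξ|) * (K * N) := by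
    rw [h00]
    calc _ ≤ |t| + |ξ * s| := abs_sub _ _
      _ = |t| + |ξ| * |s| := by rw [abs_mul]
      _ ≤ K * N + |ξ| * (K * N) := by gcongr
      _ = _ := by ring
  have c11 : |(A 1 1 : ℝ)| ≤ (1 + |ξ|) * (K * N) := by
    rw [h11]
    calc _ ≤ |q| + |ξ * s| := abs_add_le _ _
      _ = |q| + |ξ| * |s| := by rw [abs_mul]
      _ ≤ K * N + |ξ| * (K * N) := by gcongr
      _ = _ := by ring
  have c10 : |(A 1 0 : ℝ)| ≤ (1 + |ξ|) ^ 2 * (K * N) := by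
    rw [h10, ← h00]
    calc _ ≤ |p + ξ * A 0 0| + |ξ * q| := abs_sub _ _
      _ ≤ |p| + |ξ * A 0 0| + |ξ * q| := by gcongr; exact abs_add_le _ _
      _ = |p| + |ξ| * |(A 0 0 : ℝ)| + |ξ| * |q| := by rw [abs_mul, abs_mul]
      _ ≤ K * N + |ξ| * ((1 + |ξ|) * (K * N)) + |ξ| * (K * N) := by gcongr
      _ = _ := by ring
  have KN0 : 0 ≤ K * N := by positivity
  have hx : 1 + |ξ| ≤ (1 + |ξ|) ^ 2 := by nlinarith
  have hx1 : 1 ≤ (1 + |ξ|) ^ 2 := by nlinarith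
  rw [mul_assoc]
  refine mnorm_le fun i j => ?_
  fin_cases i <;> fin_cases j
  · exact c00.trans (by gcongr)
  · exact bs.trans (by nlinarith)
  · exact c10
  · exact c11.trans (by gcongr)

lemma abs_add_mul_le (ξ : ℝ) (A : M2) :
    |(A 0 0 : ℝ) + ξ * A 0 1| ≤ (1 + |ξ|) * mnorm A := by
  calc _ ≤ |(A 0 0 : ℝ)| + |ξ * A 0 1| := abs_add_le _ _
    _ = |(A 0 0 : ℝ)| + |ξ| * |(A 0 1 : ℝ)| := by rw [abs_mul]
    _ ≤ mnorm A + |ξ| * mnorm A := by gcongr <;> exact abs_entry_le_mnorm _ _ _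
    _ = _ := by ring

lemma abs_lower_right_le (ξ : ℝ) (A : M2) :
    |(A 1 1 : ℝ) - ξ * A 0 1| ≤ xiNorm ξ A := by
  rw [abs_sub_comm]
  exact le_max_right _ _

lemma abs_lower_left_le (ξ : ℝ) (A : M2) :
    |((A 1 0 : ℝ) - ξ * A 0 0) + ξ * (A 1 1 - ξ * A 0 1)| ≤ (1 + |ξ|) * xiNorm ξ A := by
  have h : |(A 1 0 : ℝ) - ξ * A 0 0| ≤ xiNorm ξ A := by
    rw [abs_sub_comm]
    exact le_max_left _ _
  calc _ ≤ |(A 1 0 : ℝ) - ξ * A 0 0| + |ξ * (A 1 1 - ξ * A 0 1)| := abs_add_le _ _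
    _ = |(A 1 0 : ℝ) - ξ * A 0 0| + |ξ| * |(A 1 1 : ℝ) - ξ * A 0 1| := by rw [abs_mul]
    _ ≤ xiNorm ξ A + |ξ| * xiNorm ξ A := by gcongr; exact abs_lower_right_le ξ A
    _ = _ := by ring

lemma xiNorm_le_mnorm (ξ : ℝ) (A : M2) : xiNorm ξ A ≤ (1 + |ξ|) * mnorm A := by
  have key : ∀ j, |ξ * (A 0 j : ℝ) - A 1 j| ≤ (1 + |ξ|) * mnorm A := fun j => by
    calc _ ≤ |ξ * (A 0 j : ℝ)| + |(A 1 j : ℝ)| := abs_sub _ _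
      _ = |ξ| * |(A 0 j : ℝ)| + |(A 1 j : ℝ)| := by rw [abs_mul]
      _ ≤ |ξ| * mnorm A + mnorm A := by gcongr <;> exact abs_entry_le_mnorm _ _ _
      _ = _ := by ring
  exact max_le (key 0) (key 1)

lemma adaptedNorm_le_mnorm {K : ℝ} (ξ : ℝ) (hK : 1 ≤ K) (A : M2) :
    adaptedNorm ξ K A ≤ 2 * K * (1 + |ξ|) ^ 2 * mnorm A := by
  have x0 := abs_nonneg ξ
  have m0 := mnorm_nonneg A
  have hx : 1 + |ξ| ≤ (1 + |ξ|) ^ 2 := by nlinarith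
  have hx1 : 1 ≤ (1 + |ξ|) ^ 2 := by nlinarith
  have hK0 : 0 < K := by linarith
  have hKx : (1 + |ξ|) ^ 2 * mnorm A ≤ K * (1 + |ξ|) ^ 2 * mnorm A := by
    rw [mul_assoc]
    exact le_mul_of_one_le_left (by positivity) hK
  have h1 := abs_add_mul_le ξ A
  have hx2 : (1 + |ξ|) * mnorm A ≤ (1 + |ξ|) ^ 2 * mnorm A := by gcongr
  have hx3 : mnorm A ≤ (1 + |ξ|) ^ 2 * mnorm A := le_mul_of_one_le_left m0 hx1
  apply max_le
  · have h2 : K * |((A 1 0 : ℝ) - ξ * A 0 0) + ξ * (A 1 1 - ξ * A 0 1)| ≤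
        K * ((1 + |ξ|) * ((1 + |ξ|) * mnorm A)) := by
      gcongr
      exact (abs_lower_left_le ξ A).trans (by gcongr; exact xiNorm_le_mnorm ξ A)
    linarith
  · have h2 : |(A 0 1 : ℝ)| / K ≤ mnorm A :=
      (div_le_self (abs_nonneg _) hK).trans (abs_entry_le_mnorm A 0 1)
    have h3 := (abs_lower_right_le ξ A).trans (xiNorm_le_mnorm ξ A)
    linarith

lemma abs_det_le (ξ : ℝ) (A : M2) : |(A.det : ℝ)| ≤ 2 * mnorm A * xiNorm ξ A := by
  have h : (A.det : ℝ) = A 0 1 * (ξ * A 0 0 - A 1 0) - A 0 0 * (ξ * A 0 1 - A 1 1) := by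
    rw [det_cast]; ring
  have h1 : |ξ * (A 0 0 : ℝ) - A 1 0| ≤ xiNorm ξ A := le_max_left _ _
  have h2 : |ξ * (A 0 1 : ℝ) - A 1 1| ≤ xiNorm ξ A := le_max_right _ _
  have m0 := mnorm_nonneg A
  rw [h]
  calc _ ≤ |(A 0 1 : ℝ) * (ξ * A 0 0 - A 1 0)| + |(A 0 0 : ℝ) * (ξ * A 0 1 - A 1 1)| := abs_sub _ _
    _ = |(A 0 1 : ℝ)| * |ξ * A 0 0 - A 1 0| + |(A 0 0 : ℝ)| * |ξ * A 0 1 - A 1 1| := by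
      rw [abs_mul, abs_mul]
    _ ≤ mnorm A * xiNorm ξ A + mnorm A * xiNorm ξ A := by
      gcongr <;> exact abs_entry_le_mnorm _ _ _
    _ = _ := by ring

lemma xiNorm_mul_abs_det_le (ξ : ℝ) (A B : M2) :
    xiNorm ξ A * |(B.det : ℝ)| ≤ 2 * xiNorm ξ (A * B) * mnorm B := by
  set y := ξ * ((A * B) 0 0 : ℝ) - (A * B) 1 0 with hy
  set z := ξ * ((A * B) 0 1 : ℝ) - (A * B) 1 1 with hz
  have h1 : |y| ≤ xiNorm ξ (A * B) := le_max_left _ _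
  have h2 : |z| ≤ xiNorm ξ (A * B) := le_max_right _ _
  have m0 := mnorm_nonneg B
  have x0 := xiNorm_nonneg ξ (A * B)
  have key : ∀ a b : ℝ, |a| ≤ mnorm B → |b| ≤ mnorm B →
      |y * a - z * b| ≤ 2 * xiNorm ξ (A * B) * mnorm B := fun a b ha hb => by
    calc _ ≤ |y * a| + |z * b| := abs_sub _ _
      _ = |y| * |a| + |z| * |b| := by rw [abs_mul, abs_mul]
      _ ≤ xiNorm ξ (A * B) * mnorm B + xiNorm ξ (A * B) * mnorm B := by gcongr
      _ = _ := by ring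
  rw [xiNorm, max_mul_of_nonneg _ _ (abs_nonneg _), ← abs_mul, ← abs_mul]
  apply max_le
  · rw [show (ξ * (A 0 0 : ℝ) - A 1 0) * B.det = y * B 1 1 - z * B 1 0 by
      rw [hy, hz, mul_entry, mul_entry, mul_entry, mul_entry, det_cast]; ring]
    exact key _ _ (abs_entry_le_mnorm _ _ _) (abs_entry_le_mnorm _ _ _)
  · rw [show (ξ * (A 0 1 : ℝ) - A 1 1) * B.det = y * -B 0 1 - z * -B 0 0 by
      rw [hy, hz, mul_entry, mul_entry, mul_entry, mul_entry, det_cast]; ring]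
    exact key _ _ (by rw [abs_neg]; exact abs_entry_le_mnorm _ _ _)
      (by rw [abs_neg]; exact abs_entry_le_mnorm _ _ _)

lemma gam_gt_one : 1 < gam := by
  have h : (1 : ℝ) < √5 := by
    rw [Real.lt_sqrt] <;> norm_num
  unfold gam
  linarith

lemma gam_mul_gam_sub_one : gam * (gam - 1) = 1 := by
  have h : √5 * √5 = (5 : ℝ) := Real.mul_self_sqrt (by norm_num)
  unfold gam
  nlinarith

lemma exists_geometric_growth {m : ℕ → ℝ} {c : ℝ} (hc : 0 < c)
    (hrec : ∀ i, 1 ≤ i → c * m i ^ gam ≤ m (i + 1))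
    (hub : ∀ C : ℝ, ∃ i, 1 ≤ i ∧ C < m i) (M : ℝ) :
    ∃ n, 1 ≤ n ∧ ∀ j : ℕ, M * 2 ^ j ≤ m (n + j) ∧ m (n + j) ≤ m (n + j + 1) := by
  have htend : Filter.Tendsto (fun x : ℝ => x ^ (gam - 1)) Filter.atTop Filter.atTop :=
    tendsto_rpow_atTop (by linarith [gam_gt_one])
  obtain ⟨T, hT⟩ := Filter.eventually_atTop.1 (htend.eventually_ge_atTop (2 / c))
  obtain ⟨n, hn, hmn⟩ := hub (max (max T M) 1)
  have h1 : (1 : ℝ) ≤ m n := (le_max_right _ _).trans hmn.le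
  have h2 : max T M ≤ m n := (le_max_left _ _).trans hmn.le
  have hdouble : ∀ k, 1 ≤ k → m n ≤ m k → 2 * m k ≤ m (k + 1) := by
    intro k hk hge
    have hpos : 0 < m k := by linarith
    have h3 := hT _ ((le_max_left _ _).trans (h2.trans hge))
    rw [div_le_iff₀ hc] at h3
    calc 2 * m k ≤ (m k ^ (gam - 1) * c) * m k := by gcongr
      _ = c * m k ^ gam := by
        rw [Real.rpow_sub_one hpos.ne']
        field_simp
      _ ≤ _ := hrec k hk
  have hgrow : ∀ j : ℕ, m n * 2 ^ j ≤ m (n + j) := by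
    intro j
    induction j with
    | zero => simp
    | succ j ih =>
      have hge : m n ≤ m (n + j) :=
        (le_mul_of_one_le_right (by linarith) (one_le_pow₀ (by norm_num))).trans ih
      calc m n * 2 ^ (j + 1) = 2 * (m n * 2 ^ j) := by ring
        _ ≤ 2 * m (n + j) := by gcongr
        _ ≤ _ := hdouble (n + j) (by omega) hge
  refine ⟨n, hn, fun j => ⟨le_trans ?_ (hgrow j), ?_⟩⟩
  · gcongr
    exact (le_max_right _ _).trans h2
  · have hge : m n ≤ m (n + j) :=
      (le_mul_of_one_le_right (by linarith) (one_le_pow₀ (by norm_num))).trans (hgrow j)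
    have := hdouble (n + j) (by omega) hge
    linarith

lemma rpow_mul_mul_le {c x y z : ℝ} (hc : 0 < c) (hx : 0 < x) (hy : 0 < y)
    (hxy : c * x ^ gam ≤ y) (hyz : c * y ^ gam ≤ z) : c ^ gam * y * x ≤ z := by
  have hg : 0 < gam - 1 := by linarith [gam_gt_one]
  have h1 : (c * x ^ gam) ^ (gam - 1) ≤ y ^ (gam - 1) :=
    Real.rpow_le_rpow (by positivity) hxy hg.le
  rw [Real.mul_rpow hc.le (by positivity), ← Real.rpow_mul hx.le, gam_mul_gam_sub_one,
    Real.rpow_one, Real.rpow_sub_one hc.ne', Real.rpow_sub_one hy.ne'] at h1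
  refine le_trans ?_ hyz
  calc c ^ gam * y * x = c * y * (c ^ gam / c * x) := by field_simp
    _ ≤ c * y * (y ^ gam / y) := by gcongr
    _ = c * y ^ gam := by field_simp

lemma mnorm_mul_le_of_xiNorm (ξ : ℝ) (A B : M2) :
    mnorm (A * B) ≤ (1 + |ξ|) * (|(A 0 0 : ℝ) + ξ * A 0 1| * mnorm B + mnorm A * xiNorm ξ B) +
      2 * xiNorm ξ A * mnorm B := by
  set t := (A 0 0 : ℝ) + ξ * A 0 1 with ht
  have mA := mnorm_nonneg A
  have mB := mnorm_nonneg B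
  have xA := xiNorm_nonneg ξ A
  have xB := xiNorm_nonneg ξ B
  have hB : ∀ j, |ξ * (B 0 j : ℝ) - B 1 j| ≤ xiNorm ξ B := by
    intro j
    fin_cases j
    · exact le_max_left _ _
    · exact le_max_right _ _
  have hA : ∀ j, |ξ * (A 0 j : ℝ) - A 1 j| ≤ xiNorm ξ A := by
    intro j
    fin_cases j
    · exact le_max_left _ _
    · exact le_max_right _ _
  have h0 : ∀ j, |((A * B) 0 j : ℝ)| ≤ |t| * mnorm B + mnorm A * xiNorm ξ B := fun j => by
    rw [show ((A * B) 0 j : ℝ) = t * B 0 j - A 0 1 * (ξ * B 0 j - B 1 j) by rw [mul_entry]; ring]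
    refine (abs_sub _ _).trans ?_
    rw [abs_mul, abs_mul]
    gcongr
    · exact abs_entry_le_mnorm _ _ _
    · exact abs_entry_le_mnorm _ _ _
    · exact hB j
  have h1 : ∀ j, |((A * B) 1 j : ℝ)| ≤ |ξ| * (|t| * mnorm B + mnorm A * xiNorm ξ B) +
      2 * xiNorm ξ A * mnorm B := fun j => by
    rw [show ((A * B) 1 j : ℝ) = ξ * (A * B) 0 j -
      ((ξ * A 0 0 - A 1 0) * B 0 j + (ξ * A 0 1 - A 1 1) * B 1 j) by
        rw [mul_entry, mul_entry]; ring]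
    refine (abs_sub _ _).trans ?_
    rw [abs_mul]
    gcongr
    · exact h0 j
    · refine (abs_add_le _ _).trans ?_
      rw [abs_mul, abs_mul]
      calc _ ≤ xiNorm ξ A * mnorm B + xiNorm ξ A * mnorm B := by
            gcongr <;> first | exact hA _ | exact abs_entry_le_mnorm _ _ _
        _ = _ := by ring
  have hS : 0 ≤ |t| * mnorm B + mnorm A * xiNorm ξ B := by positivity
  have hT : 0 ≤ 2 * xiNorm ξ A * mnorm B := by positivity
  have hU : 0 ≤ |ξ| * (|t| * mnorm B + mnorm A * xiNorm ξ B) := by positivity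
  refine mnorm_le fun i j => ?_
  fin_cases i
  · exact (h0 j).trans (by linarith)
  · exact (h1 j).trans (by linarith)

lemma mnorm_le_abs_of_mul_le {ξ c d M : ℝ} {A B : M2} (hd : 0 < d) (hM : 1 ≤ M)
    (hAB : d * mnorm A * mnorm B ≤ mnorm (A * B)) (hA : xiNorm ξ A ≤ c * (mnorm A)⁻¹)
    (hB : xiNorm ξ B ≤ c * (mnorm B)⁻¹) (hMA : M ≤ mnorm A) (hMB : M ≤ mnorm B)
    (hcM : 8 * (1 + |ξ|) * c ≤ d * M) (hc : 0 ≤ c) :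
    d * mnorm A ≤ 2 * (1 + |ξ|) * |(A 0 0 : ℝ) + ξ * A 0 1| := by
  have h := hAB.trans (mnorm_mul_le_of_xiNorm ξ A B)
  set a := mnorm A
  set b := mnorm B
  set t := |(A 0 0 : ℝ) + ξ * A 0 1|
  have ha : 1 ≤ a := hM.trans hMA
  have hb : 1 ≤ b := hM.trans hMB
  have x0 := abs_nonneg ξ
  have hcb : (1 + |ξ|) * c ≤ d / 8 * b := by nlinarith
  have hca : c ≤ d / 8 * a := by nlinarith
  have ha' : a⁻¹ ≤ 1 := inv_le_one_of_one_le₀ ha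
  have hb' : b⁻¹ ≤ 1 := inv_le_one_of_one_le₀ hb
  have e1 : (1 + |ξ|) * (a * xiNorm ξ B) ≤ d / 8 * (a * b) := by
    calc _ ≤ (1 + |ξ|) * (a * (c * b⁻¹)) := by gcongr
      _ = ((1 + |ξ|) * c) * a * b⁻¹ := by ring
      _ ≤ (d / 8 * b) * a * 1 :=
        mul_le_mul (mul_le_mul_of_nonneg_right hcb (by linarith)) hb' (by positivity)
          (by positivity)
      _ = _ := by ring
  have e2 : 2 * xiNorm ξ A * b ≤ d / 4 * (a * b) := by
    calc _ ≤ 2 * (c * a⁻¹) * b := by gcongr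
      _ ≤ 2 * (d / 8 * a * 1) * b := by gcongr
      _ = _ := by ring
  have e3 : d * a * b ≤ (2 * (1 + |ξ|) * t) * b := by
    nlinarith [mul_nonneg (mul_nonneg hd.le (by linarith : 0 ≤ a)) (by linarith : 0 ≤ b)]
  exact le_of_mul_le_mul_right e3 (by linarith)

lemma adaptedNorm_le_abs {ξ c C : ℝ} {A : M2} (hC : 1 ≤ C) (hc : 0 ≤ c) (hm : 0 < mnorm A)
    (ht : mnorm A ≤ C * |(A 0 0 : ℝ) + ξ * A 0 1|) (hA : xiNorm ξ A ≤ c * (mnorm A)⁻¹) :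
    adaptedNorm ξ C A ≤
      |(A 0 0 : ℝ) + ξ * A 0 1| * (1 + C ^ 2 * (1 + |ξ|) * c / mnorm A ^ 2) := by
  have hp := abs_lower_left_le ξ A
  have hq := abs_lower_right_le ξ A
  have hs := abs_entry_le_mnorm A 0 1
  unfold adaptedNorm
  set a := mnorm A
  set t := |(A 0 0 : ℝ) + ξ * A 0 1|
  have x0 := abs_nonneg ξ
  have hC0 : 0 < C := by linarith
  have t0 : 0 ≤ t := abs_nonneg _
  have key : C * ((1 + |ξ|) * xiNorm ξ A) ≤ t * (C ^ 2 * (1 + |ξ|) * c / a ^ 2) := by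
    calc _ ≤ C * ((1 + |ξ|) * (c * a⁻¹)) := by gcongr
      _ = C * ((1 + |ξ|) * c) / a ^ 2 * a := by field_simp
      _ ≤ C * ((1 + |ξ|) * c) / a ^ 2 * (C * t) := by gcongr
      _ = _ := by ring
  rw [mul_add, mul_one]
  apply max_le
  · refine add_le_add le_rfl (le_trans ?_ key)
    gcongr
  · refine add_le_add ?_ (le_trans ?_ key)
    · rw [div_le_iff₀ hC0]
      linarith
    · have x1 := xiNorm_nonneg ξ A
      have h1 : xiNorm ξ A ≤ (1 + |ξ|) * xiNorm ξ A := by nlinarith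
      have h2 : (1 + |ξ|) * xiNorm ξ A ≤ C * ((1 + |ξ|) * xiNorm ξ A) :=
        le_mul_of_one_le_left (by positivity) hC
      linarith

lemma adaptedNorm_mul_ge {ξ c C : ℝ} {A B : M2} (hC : 1 ≤ C) (hc : 0 ≤ c)
    (hm : 0 < mnorm A) (hm' : 0 < mnorm B)
    (htA : mnorm A ≤ C * |(A 0 0 : ℝ) + ξ * A 0 1|) (htB : mnorm B ≤ C * |(B 0 0 : ℝ) + ξ * B 0 1|)
    (hA : xiNorm ξ A ≤ c * (mnorm A)⁻¹) (hB : xiNorm ξ B ≤ c * (mnorm B)⁻¹)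
    (hAB : mnorm B ≤ mnorm A) (hx : C ^ 2 * (1 + |ξ|) * c / mnorm B ^ 2 ≤ 1 / 2) :
    adaptedNorm ξ C A * adaptedNorm ξ C B ≤
      Real.exp (4 * (C ^ 2 * (1 + |ξ|) * c / mnorm B ^ 2)) * adaptedNorm ξ C (A * B) := by
  have nA := adaptedNorm_le_abs hC hc hm htA hA
  have nB := adaptedNorm_le_abs hC hc hm' htB hB
  have hp := abs_lower_left_le ξ B
  have hs := abs_entry_le_mnorm A 0 1
  have x0 := abs_nonneg ξ
  have hC0 : 0 < C := by linarith
  have hxx : C ^ 2 * (1 + |ξ|) * c / mnorm A ^ 2 ≤ C ^ 2 * (1 + |ξ|) * c / mnorm B ^ 2 := by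
    gcongr
  set x := C ^ 2 * (1 + |ξ|) * c / mnorm B ^ 2 with hxdef
  set t := (A 0 0 : ℝ) + ξ * A 0 1 with ht
  set t' := (B 0 0 : ℝ) + ξ * B 0 1 with ht'
  set p' := ((B 1 0 : ℝ) - ξ * B 0 0) + ξ * (B 1 1 - ξ * B 0 1) with hp'
  have hx0 : 0 ≤ x := by positivity
  have hsp : |(A 0 1 : ℝ)| * |p'| ≤ |t| * |t'| * x := by
    calc _ ≤ mnorm A * ((1 + |ξ|) * (c * (mnorm B)⁻¹)) := by
          gcongr
          exact hp.trans (by gcongr)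
      _ = mnorm A * ((1 + |ξ|) * c / mnorm B ^ 2 * mnorm B) := by field_simp
      _ ≤ (C * |t|) * ((1 + |ξ|) * c / mnorm B ^ 2 * (C * |t'|)) := by gcongr
      _ = _ := by rw [hxdef]; ring
  have hlow : |t| * |t'| * (1 - x) ≤ adaptedNorm ξ C (A * B) := by
    have h1 : |t * t' + A 0 1 * p'| ≤ adaptedNorm ξ C (A * B) := by
      rw [show t * t' + A 0 1 * p' = ((A * B) 0 0 : ℝ) + ξ * (A * B) 0 1 by
        rw [mul_entry, mul_entry]; ring]
      refine le_trans ?_ (le_max_left _ _)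
      exact le_add_of_nonneg_right (by positivity)
    have h2 : |t * t'| - |(A 0 1 : ℝ) * p'| ≤ |t * t' + A 0 1 * p'| := by
      have := abs_sub_abs_le_abs_sub (t * t') (-(A 0 1 * p'))
      rwa [abs_neg, sub_neg_eq_add] at this
    rw [abs_mul, abs_mul] at h2
    linarith
  have hA1 : adaptedNorm ξ C A ≤ |t| * (1 + x) := nA.trans (by gcongr)
  have hB0 : 0 ≤ adaptedNorm ξ C B := le_trans (by positivity) (le_max_left _ _)
  have hexp : 1 + 2 * x ≤ Real.exp (2 * x) := by linarith [Real.add_one_le_exp (2 * x)]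
  have hsq : (1 + x) ^ 2 ≤ Real.exp (2 * x) := by
    have : (1 + x) ^ 2 ≤ Real.exp x ^ 2 := by
      gcongr
      linarith [Real.add_one_le_exp x]
    rwa [← Real.exp_nat_mul] at this
  have hone : 1 ≤ Real.exp (2 * x) * (1 - x) := by nlinarith
  calc _ ≤ (|t| * (1 + x)) * (|t'| * (1 + x)) := by gcongr
    _ = |t| * |t'| * (1 + x) ^ 2 := by ring
    _ ≤ |t| * |t'| * Real.exp (2 * x) := by gcongr
    _ ≤ |t| * |t'| * Real.exp (2 * x) * (Real.exp (2 * x) * (1 - x)) :=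
      le_mul_of_one_le_right (by positivity) hone
    _ = Real.exp (4 * x) * (|t| * |t'| * (1 - x)) := by
      rw [show 4 * x = 2 * x + 2 * x by ring, Real.exp_add]; ring
    _ ≤ _ := by gcongr

lemma exists_split_bound {N : List Bool → ℝ} (hpos : ∀ u, 0 < N u)
    (hmul : ∀ u v, N (u ++ v) ≤ N u * N v) {n₀ : ℕ} (hn₀ : 1 ≤ n₀) {B : ℝ} (hB : 0 ≤ B)
    (h : ∀ j : ℕ, N (fw (n₀ + j + 1)) * N (fw (n₀ + j)) ≤
      Real.exp (B / 2 ^ j) * N (fw (n₀ + j + 2))) :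
    ∃ D : ℝ, 0 < D ∧ ∀ n u v, u ++ v = fw n → N u * N v ≤ D * N (fw n) := by
  have hsplit : ∀ n, ∃ D : ℝ, 0 < D ∧ ∀ u v, u ++ v = fw n → N u * N v ≤ D * N (fw n) := by
    intro n
    refine ⟨∑ k ∈ Finset.range ((fw n).length + 1),
      N ((fw n).take k) * N ((fw n).drop k) / N (fw n), ?_, ?_⟩
    · refine Finset.sum_pos (fun k _ => ?_) (by simp)
      exact div_pos (mul_pos (hpos _) (hpos _)) (hpos _)
    · intro u v huv
      rw [← div_le_iff₀ (hpos _)]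
      have hlen : u.length ∈ Finset.range ((fw n).length + 1) := by
        rw [← huv]
        simp only [List.length_append, Finset.mem_range]
        omega
      have := Finset.single_le_sum (f := fun k => N ((fw n).take k) * N ((fw n).drop k) / N (fw n))
        (fun k _ => (div_pos (mul_pos (hpos _) (hpos _)) (hpos _)).le) hlen
      simpa [← huv] using this
  choose D hD hsp using hsplit
  set D' := ∑ k ∈ Finset.range (n₀ + 2), D k with hD'
  have hD'pos : 0 < D' := Finset.sum_pos (fun k _ => hD k) (by simp)
  have hDle : ∀ k < n₀ + 2, D k ≤ D' := fun k hk =>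
    Finset.single_le_sum (fun i _ => (hD i).le) (Finset.mem_range.2 hk)
  have hlarge : ∀ (j : ℕ) u v, u ++ v = fw (n₀ + j) →
      N u * N v ≤ D' * Real.exp (4 * B * (1 - 1 / 2 ^ j)) * N (fw (n₀ + j)) := by
    intro j
    have hsmall : ∀ j < 2, ∀ u v, u ++ v = fw (n₀ + j) →
        N u * N v ≤ D' * Real.exp (4 * B * (1 - 1 / 2 ^ j)) * N (fw (n₀ + j)) := by
      intro j hj u v huv
      refine (hsp _ u v huv).trans ?_
      have h1 := hDle (n₀ + j) (by omega)
      have h2 : 1 ≤ Real.exp (4 * B * (1 - 1 / 2 ^ j)) := by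
        apply Real.one_le_exp
        have : (1 : ℝ) / 2 ^ j ≤ 1 := by
          rw [div_le_one (by positivity)]
          exact one_le_pow₀ (by norm_num)
        have h3 : 0 ≤ 1 - (1 : ℝ) / 2 ^ j := by linarith
        positivity
      have := hpos (fw (n₀ + j))
      gcongr
      exact h1.trans (le_mul_of_one_le_right hD'pos.le h2)
    induction j using Nat.twoStepInduction with
    | zero => exact hsmall 0 (by norm_num)
    | one => exact hsmall 1 (by norm_num)
    | more j ih1 ih2 =>
      intro u v huv
      have e : fw (n₀ + (j + 2)) = fw (n₀ + (j + 1)) ++ fw (n₀ + j) := by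
        obtain ⟨m, rfl⟩ : ∃ m, n₀ = m + 1 := ⟨n₀ - 1, by omega⟩
        rw [show m + 1 + (j + 2) = m + j + 3 by ring, show m + 1 + (j + 1) = m + j + 2 by ring,
          show m + 1 + j = m + j + 1 by ring]
        rfl
      have hq : (0 : ℝ) < 1 / 2 ^ j := by positivity
      have hj := h j
      have p0 := hpos (fw (n₀ + j))
      have p1 := hpos (fw (n₀ + (j + 1)))
      have p2 := hpos (fw (n₀ + (j + 2)))
      have step : ∀ y, y ≤ 4 * B * (1 - 1 / 2 ^ (j + 1)) →
          D' * Real.exp y * (N (fw (n₀ + (j + 1))) * N (fw (n₀ + j))) ≤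
          D' * Real.exp (4 * B * (1 - 1 / 2 ^ (j + 2))) * N (fw (n₀ + (j + 2))) := by
        intro y hy
        calc _ ≤ D' * Real.exp y * (Real.exp (B / 2 ^ j) * N (fw (n₀ + (j + 2)))) :=
              mul_le_mul_of_nonneg_left hj (by positivity)
          _ = D' * Real.exp (y + B / 2 ^ j) * N (fw (n₀ + (j + 2))) := by
              rw [Real.exp_add]; ring
          _ ≤ _ := by
              gcongr
              refine (add_le_add_left hy _).trans (le_of_eq ?_)
              rw [pow_succ, pow_add]
              field_simp
              ring
      rw [e, List.append_eq_append_iff] at huv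
      rcases huv with ⟨w, h1, h2⟩ | ⟨w, h1, h2⟩
      · have i2 := ih2 u w h1.symm
        have pu := hpos u
        calc N u * N v ≤ N u * (N w * N (fw (n₀ + j))) := by
              gcongr
              rw [h2]
              exact hmul _ _
          _ = (N u * N w) * N (fw (n₀ + j)) := by ring
          _ ≤ (D' * Real.exp (4 * B * (1 - 1 / 2 ^ (j + 1))) * N (fw (n₀ + (j + 1)))) *
              N (fw (n₀ + j)) := by gcongr
          _ = D' * Real.exp (4 * B * (1 - 1 / 2 ^ (j + 1))) *
              (N (fw (n₀ + (j + 1))) * N (fw (n₀ + j))) := by ring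
          _ ≤ _ := step _ le_rfl
      · have i1 := ih1 w v h2.symm
        have pv := hpos v
        calc N u * N v ≤ (N (fw (n₀ + (j + 1))) * N w) * N v := by
              gcongr
              rw [h1]
              exact hmul _ _
          _ = N (fw (n₀ + (j + 1))) * (N w * N v) := by ring
          _ ≤ N (fw (n₀ + (j + 1))) * (D' * Real.exp (4 * B * (1 - 1 / 2 ^ j)) *
              N (fw (n₀ + j))) := by gcongr
          _ = D' * Real.exp (4 * B * (1 - 1 / 2 ^ j)) *
              (N (fw (n₀ + (j + 1))) * N (fw (n₀ + j))) := by ring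
          _ ≤ _ := step _ (by
              rw [pow_succ]
              have : (1 : ℝ) / (2 ^ j * 2) ≤ 1 / 2 ^ j := by
                rw [← div_div]
                linarith
              gcongr)
  refine ⟨D' * Real.exp (4 * B), by positivity, fun n u v huv => ?_⟩
  have pn := hpos (fw n)
  rcases lt_or_ge n n₀ with hn | hn
  · refine (hsp n u v huv).trans ?_
    gcongr
    exact (hDle n (by omega)).trans
      (le_mul_of_one_le_right hD'pos.le (Real.one_le_exp (by positivity)))
  · obtain ⟨j, rfl⟩ := Nat.exists_eq_add_of_le hn
    have h1 : (0 : ℝ) < 1 / 2 ^ j := by positivity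
    have h2 : 4 * B * (1 - 1 / 2 ^ j) ≤ 4 * B :=
      mul_le_of_le_one_right (by positivity) (by linarith)
    refine (hlarge j u v huv).trans ?_
    exact mul_le_mul_of_nonneg_right
      (mul_le_mul_of_nonneg_left (Real.exp_le_exp.2 h2) hD'pos.le) pn.le

lemma exists_adaptedNorm_split_bound {ξ : ℝ} {W : ℕ → M2} (hW : IsAssociated ξ W) :
    ∃ K D : ℝ, 1 ≤ K ∧ 0 < D ∧ ∀ n u v, u ++ v = fw n →
      adaptedNorm ξ K (wordProd (W 1) (W 2) u) * adaptedNorm ξ K (wordProd (W 1) (W 2) v) ≤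
        D * adaptedNorm ξ K (wordProd (W 1) (W 2) (fw n)) := by
  obtain ⟨hfib, hub, -, c₁, _, _, c₄, _, _, h₁, -, -, h₄, -, -, hb⟩ := hW
  have hdet : ∀ i, 1 ≤ i → (W i).det ≠ 0 := fun i hi => (hfib.1 i hi).2
  have hm1 : ∀ i, 1 ≤ i → 1 ≤ mnorm (W i) := fun i hi => one_le_mnorm (hdet i hi)
  have x0 := abs_nonneg ξ
  set d := c₁ ^ gam with hd
  have hd0 : 0 < d := by positivity
  set C := max 1 (2 * (1 + |ξ|) / d) with hC
  have hC1 : 1 ≤ C := le_max_left _ _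
  set E := C ^ 2 * (1 + |ξ|) * c₄ with hE
  have hE0 : 0 ≤ E := by positivity
  set M := 1 + 8 * (1 + |ξ|) * c₄ / d + 2 * E with hM
  have hM0 : 0 ≤ 8 * (1 + |ξ|) * c₄ / d := by positivity
  obtain ⟨n, hn, hgrow⟩ := exists_geometric_growth (m := fun i => mnorm (W i)) h₁
    (fun i hi => (hb i hi).1) hub M
  have hMW : ∀ j, M ≤ mnorm (W (n + j)) := fun j =>
    (le_mul_of_one_le_right (by linarith) (one_le_pow₀ (by norm_num))).trans (hgrow j).1
  have hprod : ∀ j, d * mnorm (W (n + j + 1)) * mnorm (W (n + j)) ≤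
      mnorm (W (n + j + 1) * W (n + j)) := by
    intro j
    have h2 := rpow_mul_mul_le h₁ (by linarith [hm1 (n + j) (by omega)])
      (by linarith [hm1 (n + j + 1) (by omega)]) (hb (n + j) (by omega)).1
      (hb (n + j + 1) (by omega)).1
    refine h2.trans ?_
    have hne : content (W (n + j + 1) * W (n + j)) ≠ 0 := by
      apply content_ne_zero
      rw [Matrix.det_mul]
      exact mul_ne_zero (hdet _ (by omega)) (hdet _ (by omega))
    have h3 : mnorm (W (n + j + 1) * W (n + j)) =
        content (W (n + j + 1) * W (n + j)) * mnorm (W (n + j + 1 + 1)) := by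
      rw [← mnorm_nsmul, show n + j + 1 + 1 = n + j + 2 by ring, hfib.2 (n + j) (by omega), pmul,
        content_nsmul_red]
    rw [h3]
    exact le_mul_of_one_le_left (mnorm_nonneg _) (by exact_mod_cast Nat.one_le_iff_ne_zero.2 hne)
  have ht : ∀ j, mnorm (W (n + j + 1)) ≤
      C * |(W (n + j + 1) 0 0 : ℝ) + ξ * W (n + j + 1) 0 1| := by
    intro j
    have h2 := mnorm_le_abs_of_mul_le (M := M) hd0 (by linarith) (hprod j)
      (hb (n + j + 1) (by omega)).2.2.2.1 (hb (n + j) (by omega)).2.2.2.1 (hMW (j + 1)) (hMW j)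
      (by
        calc 8 * (1 + |ξ|) * c₄ = d * (8 * (1 + |ξ|) * c₄ / d) := by field_simp
          _ ≤ d * M := by gcongr; linarith) h₄.le
    calc mnorm (W (n + j + 1)) ≤ 2 * (1 + |ξ|) / d *
          |(W (n + j + 1) 0 0 : ℝ) + ξ * W (n + j + 1) 0 1| := by
          rw [div_mul_eq_mul_div, le_div_iff₀ hd0]
          linarith
      _ ≤ _ := by gcongr; exact le_max_right _ _
  have hpos : ∀ u, 0 < adaptedNorm ξ C (wordProd (W 1) (W 2) u) := by
    intro u
    have h2 := one_le_mnorm (wordProd_det_ne_zero (hdet 1 le_rfl) (hdet 2 (by norm_num)) u)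
    have h3 := mnorm_le_adaptedNorm ξ hC1 (wordProd (W 1) (W 2) u)
    exact pos_of_mul_pos_right (by linarith : 0 < (1 + |ξ|) ^ 2 * C * _) (by positivity)
  obtain ⟨D, hD, hsplit⟩ := exists_split_bound hpos (fun u v => by
    rw [wordProd_append]
    exact adaptedNorm_mul_le ξ (by linarith) _ _) (n₀ := n + 1) (by omega)
    (B := 4 * E) (by positivity) (fun j => by
      obtain ⟨a, -, ha⟩ := exists_wordProd_fw_eq_nsmul hfib (n + (j + 1))
      obtain ⟨b, -, hb'⟩ := exists_wordProd_fw_eq_nsmul hfib (n + j)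
      have e : fw (n + 1 + j + 2) = fw (n + (j + 1) + 1) ++ fw (n + j + 1) := by
        rw [show n + 1 + j + 2 = n + j + 3 by ring]
        rfl
      rw [e, wordProd_append, show n + 1 + j + 1 = n + (j + 1) + 1 by ring,
        show n + 1 + j = n + j + 1 by ring, ha, hb', smul_mul_assoc, mul_smul_comm,
        adaptedNorm_nsmul, adaptedNorm_nsmul, adaptedNorm_nsmul, adaptedNorm_nsmul]
      have hg := hgrow (j + 1)
      have hmB : 2 ^ j ≤ mnorm (W (n + j + 1)) ^ 2 := by
        have h3 : (1 : ℝ) * 2 ^ (j + 1) ≤ mnorm (W (n + j + 1)) :=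
          le_trans (by gcongr; linarith) hg.1
        rw [pow_succ] at h3
        have h4 : (0 : ℝ) < 2 ^ j := by positivity
        nlinarith [hm1 (n + j + 1) (by omega)]
      have hhalf : E / mnorm (W (n + j + 1)) ^ 2 ≤ 1 / 2 := by
        have h3 := hMW (j + 1)
        have h4 : 1 ≤ mnorm (W (n + (j + 1))) := hm1 _ (by omega)
        rw [div_le_iff₀ (by positivity)]
        change E ≤ 1 / 2 * mnorm (W (n + (j + 1))) ^ 2
        nlinarith
      have h2 := adaptedNorm_mul_ge hC1 h₄.le (by linarith [hm1 (n + (j + 1) + 1) (by omega)])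
        (by linarith [hm1 (n + j + 1) (by omega)]) (ht (j + 1)) (ht j)
        (hb (n + (j + 1) + 1) (by omega)).2.2.2.1 (hb (n + j + 1) (by omega)).2.2.2.1 hg.2 hhalf
      have hexp : Real.exp (4 * (E / mnorm (W (n + j + 1)) ^ 2)) ≤ Real.exp (4 * E / 2 ^ j) := by
        apply Real.exp_le_exp.2
        rw [mul_div_assoc 4 E]
        gcongr
      have hAB0 : 0 ≤ adaptedNorm ξ C (W (n + (j + 1) + 1) * W (n + j + 1)) :=
        le_trans (by positivity) (le_max_left _ _)
      calc _ = (a * b : ℝ) * (adaptedNorm ξ C (W (n + (j + 1) + 1)) *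
            adaptedNorm ξ C (W (n + j + 1))) := by ring
        _ ≤ (a * b : ℝ) * (Real.exp (4 * E / 2 ^ j) *
            adaptedNorm ξ C (W (n + (j + 1) + 1) * W (n + j + 1))) := by
          refine mul_le_mul_of_nonneg_left (h2.trans ?_) (by positivity)
          exact mul_le_mul_of_nonneg_right hexp hAB0
        _ = _ := by ring)
  exact ⟨C, D, hC1, hD, hsplit⟩

lemma exists_mnorm_split_bound {ξ : ℝ} {W : ℕ → M2} (hW : IsAssociated ξ W) :
    ∃ D : ℝ, 0 < D ∧ ∀ n u v, u ++ v = fw n →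
      mnorm (wordProd (W 1) (W 2) u) * mnorm (wordProd (W 1) (W 2) v) ≤
        D * mnorm (wordProd (W 1) (W 2) (fw n)) := by
  obtain ⟨K, D, hK, hD, h⟩ := exists_adaptedNorm_split_bound hW
  set a := (1 + |ξ|) ^ 2 * K with ha
  have ha0 : 0 < a := by positivity
  refine ⟨a * a * D * (2 * K * (1 + |ξ|) ^ 2), by positivity, fun n u v huv => ?_⟩
  calc _ ≤ (a * adaptedNorm ξ K (wordProd (W 1) (W 2) u)) *
        (a * adaptedNorm ξ K (wordProd (W 1) (W 2) v)) :=
        mul_le_mul (mnorm_le_adaptedNorm ξ hK _) (mnorm_le_adaptedNorm ξ hK _) (mnorm_nonneg _)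
          ((mnorm_nonneg _).trans (mnorm_le_adaptedNorm ξ hK _))
    _ = a * a * (adaptedNorm ξ K (wordProd (W 1) (W 2) u) *
        adaptedNorm ξ K (wordProd (W 1) (W 2) v)) := by ring
    _ ≤ a * a * (D * (2 * K * (1 + |ξ|) ^ 2 * mnorm (wordProd (W 1) (W 2) (fw n)))) := by
        refine mul_le_mul_of_nonneg_left ((h n u v huv).trans ?_) (by positivity)
        exact mul_le_mul_of_nonneg_left (adaptedNorm_le_mnorm ξ hK _) hD.le
    _ = _ := by ring

lemma exists_xiNorm_mul_mnorm_fw_le {ξ : ℝ} {W : ℕ → M2} (hW : IsAssociated ξ W) :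
    ∃ c : ℝ, 0 < c ∧ ∀ n, 1 ≤ n →
      xiNorm ξ (wordProd (W 1) (W 2) (fw n)) * mnorm (wordProd (W 1) (W 2) (fw n)) ≤
        c * |((wordProd (W 1) (W 2) (fw n)).det : ℝ)| := by
  obtain ⟨hfib, -, -, _, _, _, c₄, c₅, _, -, -, -, h₄, h₅, -, hb⟩ := hW
  refine ⟨c₄ / c₅, by positivity, fun n hn => ?_⟩
  obtain ⟨k, rfl⟩ : ∃ k, n = k + 1 := ⟨n - 1, by omega⟩
  obtain ⟨c, -, h⟩ := exists_wordProd_fw_eq_nsmul hfib k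
  have hbk := hb (k + 1) hn
  have hm : 0 < mnorm (W (k + 1)) := by linarith [one_le_mnorm (hfib.1 (k + 1) hn).2]
  have h1 : xiNorm ξ (W (k + 1)) * mnorm (W (k + 1)) ≤ c₄ := by
    have := hbk.2.2.2.1
    rwa [← div_eq_mul_inv, le_div_iff₀ hm] at this
  have h2 : c₄ ≤ c₄ / c₅ * |((W (k + 1)).det : ℝ)| := by
    rw [div_mul_eq_mul_div, le_div_iff₀ h₅]
    exact mul_le_mul_of_nonneg_left hbk.2.2.2.2.1 h₄.le
  rw [h, xiNorm_nsmul, mnorm_nsmul, abs_det_nsmul]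
  calc _ = (c : ℝ) ^ 2 * (xiNorm ξ (W (k + 1)) * mnorm (W (k + 1))) := by ring
    _ ≤ (c : ℝ) ^ 2 * (c₄ / c₅ * |((W (k + 1)).det : ℝ)|) :=
      mul_le_mul_of_nonneg_left (h1.trans h2) (by positivity)
    _ = _ := by ring

/-- For U_i = Φ(u_i), u_i the prefix of f_{a,b} of length i, one has
‖(ξ,-1)U_i‖ ≍ |det U_i| / ‖U_i‖. -/
theorem stmt5 (ξ : ℝ) (W : ℕ → M2) (hξ : IsExtremal ξ) (hW : IsAssociated ξ W) :
    ∃ c₁ c₂ : ℝ, 0 < c₁ ∧ 0 < c₂ ∧ ∀ i, 1 ≤ i →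
      c₁ * |((PhiW (W 1) (W 2) (fpref i)).det : ℝ)| / mnorm (PhiW (W 1) (W 2) (fpref i)) ≤
        xiNorm ξ (PhiW (W 1) (W 2) (fpref i)) ∧
      xiNorm ξ (PhiW (W 1) (W 2) (fpref i)) ≤
        c₂ * |((PhiW (W 1) (W 2) (fpref i)).det : ℝ)| / mnorm (PhiW (W 1) (W 2) (fpref i)) := by
  have hfib := hW.1
  have hd1 : (W 1).det ≠ 0 := (hfib.1 1 le_rfl).2
  have hd2 : (W 2).det ≠ 0 := (hfib.1 2 (by norm_num)).2
  obtain ⟨D, hD, hsplit⟩ := exists_mnorm_split_bound hW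
  obtain ⟨c, hc, hfw⟩ := exists_xiNorm_mul_mnorm_fw_le hW
  have hupper : ∀ i, xiNorm ξ (wordProd (W 1) (W 2) (fpref i)) *
      mnorm (wordProd (W 1) (W 2) (fpref i)) ≤
        2 * c * D * |((wordProd (W 1) (W 2) (fpref i)).det : ℝ)| := by
    intro i
    have huv : fpref i ++ (fw (i + 2)).drop i = fw (i + 2) := List.take_append_drop i (fw (i + 2))
    set v := (fw (i + 2)).drop i
    have h1 := hsplit _ _ _ huv
    have h2 := hfw (i + 2) (by omega)
    have h3 := xiNorm_mul_abs_det_le ξ (wordProd (W 1) (W 2) (fpref i)) (wordProd (W 1) (W 2) v)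
    rw [← wordProd_append, huv] at h3
    have hdet : |((wordProd (W 1) (W 2) (fw (i + 2))).det : ℝ)| =
        |((wordProd (W 1) (W 2) (fpref i)).det : ℝ)| * |((wordProd (W 1) (W 2) v).det : ℝ)| := by
      rw [← huv, wordProd_append, Matrix.det_mul, Int.cast_mul, abs_mul]
    have hdv : 0 < |((wordProd (W 1) (W 2) v).det : ℝ)| :=
      abs_pos.2 (Int.cast_ne_zero.2 (wordProd_det_ne_zero hd1 hd2 v))
    have hmQ : 0 < mnorm (wordProd (W 1) (W 2) (fw (i + 2))) := by
      linarith [one_le_mnorm (wordProd_det_ne_zero hd1 hd2 (fw (i + 2)))]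
    rw [hdet] at h2
    have mu := mnorm_nonneg (wordProd (W 1) (W 2) (fpref i))
    have mv := mnorm_nonneg (wordProd (W 1) (W 2) v)
    have du := abs_nonneg ((wordProd (W 1) (W 2) (fpref i)).det : ℝ)
    set x := xiNorm ξ (wordProd (W 1) (W 2) (fpref i))
    set a := mnorm (wordProd (W 1) (W 2) (fpref i))
    set b := mnorm (wordProd (W 1) (W 2) v)
    set q := mnorm (wordProd (W 1) (W 2) (fw (i + 2)))
    set y := xiNorm ξ (wordProd (W 1) (W 2) (fw (i + 2)))
    set δ := |((wordProd (W 1) (W 2) (fpref i)).det : ℝ)|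
    set ε := |((wordProd (W 1) (W 2) v).det : ℝ)|
    refine le_of_mul_le_mul_right (a := ε * q) ?_ (by positivity)
    calc x * a * (ε * q) = (x * ε) * (a * q) := by ring
      _ ≤ (2 * y * b) * (a * q) := by gcongr
      _ = 2 * (y * q) * (a * b) := by ring
      _ ≤ 2 * (c * (δ * ε)) * (D * q) := by gcongr
      _ = 2 * c * D * δ * (ε * q) := by ring
  refine ⟨1 / 2, 2 * c * D, by norm_num, by positivity, fun i _ => ?_⟩
  obtain ⟨k, hk, h⟩ := exists_wordProd_eq_nsmul_PhiW hd1 hd2 (fpref i)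
  have hk0 : (0 : ℝ) < (k : ℝ) ^ 2 := by positivity
  have hU : (PhiW (W 1) (W 2) (fpref i)).det ≠ 0 := by
    have hP := wordProd_det_ne_zero hd1 hd2 (fpref i)
    rw [h, Matrix.det_smul_of_tower] at hP
    exact right_ne_zero_of_smul hP
  have hm : 0 < mnorm (PhiW (W 1) (W 2) (fpref i)) := by linarith [one_le_mnorm hU]
  have hup := hupper i
  rw [h, xiNorm_nsmul, mnorm_nsmul, abs_det_nsmul] at hup
  rw [div_le_iff₀ hm, le_div_iff₀ hm]
  refine ⟨by linarith [abs_det_le ξ (PhiW (W 1) (W 2) (fpref i))], ?_⟩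
  refine le_of_mul_le_mul_left ?_ hk0
  linarith
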